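/- Let f ∈ H↑. If limsup_{n→∞} (f(n+1) − f(n)) < ∞, then the quotient set S_f has exactly one element. -/

import Mathlib

open Filter

/-- `cnt A n` is the cardinality of `A ∩ {0, …, n-1}`. -/
noncomputable def cnt (A : Set ℕ) (n : ℕ) : ℕ := (A ∩ Set.Iio n).ncard

/-- `G` : functions `g : ω → (0,∞)` with `g n → ∞` and `n / g n` not tending to `0`. -/
def inG (g : ℕ → ℝ) : Prop :=
  (∀ n, 0 < g n) ∧ Tendsto g atTop atTop ∧
    ¬ Tendsto (fun n : ℕ => (n : ℝ) / g n) atTop (nhds 0)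

/-- The simple density ideal `Z_g`. -/
def Zg (g : ℕ → ℝ) : Set (Set ℕ) :=
  {A | Tendsto (fun n => (cnt A n : ℝ) / g n) atTop (nhds 0)}

/-- `Z_g` for an `ω`-valued function. -/
def ZgN (g : ℕ → ℕ) : Set (Set ℕ) := Zg (fun n => (g n : ℝ))

/-- `H↑` : nondecreasing members of `G` with values in `ω`. -/
def inHup (f : ℕ → ℕ) : Prop := inG (fun n => (f n : ℝ)) ∧ Monotone f

open scoped ENNReal

/-- The relation `R`: `g R h` iff `limsup g(n)/h(n) < ∞` and `limsup h(n)/g(n) < ∞`. -/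
def Rrel (g h : ℕ → ℕ) : Prop :=
  limsup (fun n => (g n : ℝ≥0∞) / (h n : ℝ≥0∞)) atTop < ⊤ ∧
  limsup (fun n => (h n : ℝ≥0∞) / (g n : ℝ≥0∞)) atTop < ⊤

/-- `S_f` : the quotient of `{g ∈ H↑ : Z_f = Z_g}` by the relation `R`. -/
def Sf (f : ℕ → ℕ) : Type :=
  Quot (fun g h : {g : ℕ → ℕ // inHup g ∧ ZgN g = ZgN f} => Rrel g.1 h.1)

lemma mem_ZgN_iff (w : ℕ → ℕ) (A : Set ℕ) :
    A ∈ ZgN w ↔ Tendsto (fun n => (cnt A n : ℝ) / w n) atTop (nhds 0) := Iff.rfl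

lemma cnt_le_of_inter_subset {A : Set ℕ} {n : ℕ} {s : Finset ℕ}
    (h : A ∩ Set.Iio n ⊆ s) : cnt A n ≤ s.card := by
  simpa [cnt] using Set.ncard_le_ncard h s.finite_toSet

lemma card_le_cnt {A : Set ℕ} {n : ℕ} {s : Finset ℕ}
    (h : (s : Set ℕ) ⊆ A ∩ Set.Iio n) : s.card ≤ cnt A n := by
  simpa [cnt] using Set.ncard_le_ncard h ((Set.finite_Iio n).inter_of_right A)

/-- A union of increasingly separated blocks, each negligible for `w` but not for `u`,
witnesses that `Z_w` is not contained in `Z_u`. -/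
lemma exists_mem_ZgN_notMem_ZgN {w u : ℕ → ℕ} (hw : Monotone w) (hwt : Tendsto w atTop atTop)
    (hwpos : ∀ n, 0 < w n) (hupos : ∀ n, 0 < u n) (C : ℕ)
    (hblock : ∀ k N, ∃ a b, N ≤ a ∧ a ≤ b ∧ k * (b - a) ≤ w a ∧ u b ≤ C * (b - a)) :
    ∃ A ∈ ZgN w, A ∉ ZgN u := by
  have hblock' : ∀ k N, ∃ a b, N ≤ a ∧ a < b ∧ k * N ≤ w a ∧ k * (b - a) ≤ w a ∧
      u b ≤ C * (b - a) := by
    intro k N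
    obtain ⟨N', hN'⟩ := eventually_atTop.1 (hwt.eventually_ge_atTop (k * N))
    obtain ⟨a, b, ha, hab, h1, h2⟩ := hblock k (max N N')
    refine ⟨a, b, (le_max_left _ _).trans ha, lt_of_le_of_ne hab ?_,
      hN' a ((le_max_right _ _).trans ha), h1, h2⟩
    rintro rfl
    have := hupos a
    simp at h2
    omega
  choose α β hα hαβ hprev hsmall hlarge using hblock'
  let N : ℕ → ℕ := fun k => Nat.rec 0 (fun k m => β k m) k
  let a : ℕ → ℕ := fun k => α k (N k)
  have hNa : ∀ k, N k ≤ a k := fun k => hα k (N k)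
  have haN : ∀ k, a k < N (k + 1) := fun k => hαβ k (N k)
  have hNmono : Monotone N := monotone_nat_of_le_succ fun k => (hNa k).trans (haN k).le
  have hamono : StrictMono a := strictMono_nat_of_lt_succ fun k => (haN k).trans_le (hNa (k + 1))
  let A : Set ℕ := {x | ∃ k, a k ≤ x ∧ x < N (k + 1)}
  have hupper : ∀ k n, a k ≤ n → n < a (k + 1) → k * cnt A n ≤ 2 * w n := by
    intro k n h1 h2
    have hc : cnt A n ≤ N k + (N (k + 1) - a k) := by
      refine (cnt_le_of_inter_subset
        (s := Finset.range (N k) ∪ Finset.Ico (a k) (N (k + 1))) ?_).trans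
        ((Finset.card_union_le _ _).trans (by simp))
      rintro x ⟨⟨j, hj1, hj2⟩, hx⟩
      simp only [Set.mem_Iio] at hx
      simp only [Finset.coe_union, Finset.coe_range, Finset.coe_Ico, Set.mem_union, Set.mem_Iio,
        Set.mem_Ico]
      rcases lt_trichotomy j k with hjk | rfl | hjk
      · exact Or.inl (hj2.trans_le (hNmono hjk))
      · exact Or.inr ⟨hj1, hj2⟩
      · have := hamono.monotone (Nat.succ_le_of_lt hjk)
        simp only [Nat.succ_eq_add_one] at this
        omega
    have e1 : k * N k ≤ w (a k) := hprev k (N k)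
    have e2 : k * (N (k + 1) - a k) ≤ w (a k) := hsmall k (N k)
    have e3 := hw h1
    have e4 := Nat.mul_le_mul_left k hc
    rw [Nat.mul_add] at e4
    omega
  refine ⟨A, ?_, ?_⟩
  · rw [mem_ZgN_iff, Metric.tendsto_atTop]
    intro ε hε
    obtain ⟨K, hK⟩ := exists_nat_gt (2 / ε)
    refine ⟨a K, fun n hn => ?_⟩
    obtain ⟨k, hk, h1, h2⟩ : ∃ k, K ≤ k ∧ a k ≤ n ∧ n < a (k + 1) := by
      have hex : ∃ k, n < a k := ⟨n + 1, (Nat.lt_succ_self n).trans_le (hamono.id_le _)⟩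
      have hlt : K < Nat.find hex := by
        by_contra! hle
        exact absurd (Nat.find_spec hex) (not_lt.2 ((hamono.monotone hle).trans hn))
      obtain ⟨k, hk⟩ := Nat.exists_eq_succ_of_ne_zero (Nat.ne_zero_of_lt hlt)
      refine ⟨k, by omega, not_lt.1 (Nat.find_min hex (by omega)), ?_⟩
      have := Nat.find_spec hex
      rwa [hk] at this
    have hkc : (k : ℝ) * cnt A n ≤ 2 * w n := by exact_mod_cast hupper k n h1 h2
    have hwn : (0 : ℝ) < w n := by exact_mod_cast hwpos n
    have hkε : 2 / ε < k := hK.trans_le (by exact_mod_cast hk)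
    have hk0 : (0 : ℝ) < k := (by positivity : (0 : ℝ) < 2 / ε).trans hkε
    rw [div_lt_iff₀ hε] at hkε
    rw [Real.dist_eq, sub_zero, abs_of_nonneg (by positivity), div_lt_iff₀ hwn]
    refine lt_of_mul_lt_mul_left ?_ hk0.le
    nlinarith
  · rw [mem_ZgN_iff]
    intro ht
    have hev := ht.eventually (gt_mem_nhds (by positivity : (0 : ℝ) < 1 / (C + 1)))
    obtain ⟨n₀, hn₀⟩ := eventually_atTop.1 hev
    have hbig : n₀ ≤ N (n₀ + 1) := (hamono.id_le n₀).trans (haN n₀).le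
    have hlt := hn₀ _ hbig
    have hu : (0 : ℝ) < u (N (n₀ + 1)) := by exact_mod_cast hupos _
    rw [div_lt_div_iff₀ hu (by positivity), one_mul] at hlt
    have hlt' : cnt A (N (n₀ + 1)) * (C + 1) < u (N (n₀ + 1)) := by exact_mod_cast hlt
    have hc : N (n₀ + 1) - a n₀ ≤ cnt A (N (n₀ + 1)) := by
      have := card_le_cnt (A := A) (n := N (n₀ + 1)) (s := Finset.Ico (a n₀) (N (n₀ + 1))) (by
        intro x hx
        simp only [Finset.coe_Ico, Set.mem_Ico] at hx
        exact ⟨⟨n₀, hx⟩, hx.2⟩)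
      simpa using this
    have hl : u (N (n₀ + 1)) ≤ C * (N (n₀ + 1) - a n₀) := hlarge n₀ (N n₀)
    nlinarith [Nat.mul_le_mul_left C hc]

lemma inHup.pos {f : ℕ → ℕ} (hf : inHup f) (n : ℕ) : 0 < f n :=
  Nat.cast_pos.1 (hf.1.1 n)

lemma inHup.tendsto {f : ℕ → ℕ} (hf : inHup f) : Tendsto f atTop atTop :=
  tendsto_natCast_atTop_iff.1 hf.1.2.1

lemma exists_forall_succ_le_add {f : ℕ → ℕ}
    (h : limsup (fun n => ((f (n + 1) - f n : ℕ) : ℝ≥0∞)) atTop < ⊤) :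
    ∃ M, ∀ n, f (n + 1) ≤ f n + M := by
  obtain ⟨c, hc, hc'⟩ := exists_between h
  obtain ⟨m, hm⟩ := ENNReal.exists_nat_gt hc'.ne
  obtain ⟨n₀, hn₀⟩ := eventually_atTop.1 (eventually_lt_of_limsup_lt hc)
  refine ⟨max m ((Finset.range n₀).sup fun n => f (n + 1)), fun n => ?_⟩
  rcases lt_or_ge n n₀ with hn | hn
  · have := Finset.le_sup (f := fun n => f (n + 1)) (Finset.mem_range.2 hn)
    have := le_max_right m ((Finset.range n₀).sup fun n => f (n + 1))
    omega
  · have : f (n + 1) - f n < m := by exact_mod_cast (hn₀ n hn).trans hm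
    have := le_max_left m ((Finset.range n₀).sup fun n => f (n + 1))
    omega

lemma le_add_mul_of_succ_le_add {f : ℕ → ℕ} {M : ℕ} (hM : ∀ n, f (n + 1) ≤ f n + M) (n j : ℕ) :
    f (n + j) ≤ f n + M * j := by
  induction j with
  | zero => simp
  | succ j ih =>
    have := hM (n + j)
    rw [← Nat.add_assoc, Nat.mul_succ]
    omega

lemma limsup_div_lt_top {g h : ℕ → ℕ} {K : ℕ} (hK : ∀ᶠ n in atTop, g n ≤ K * h n) :
    limsup (fun n => (g n : ℝ≥0∞) / (h n : ℝ≥0∞)) atTop < ⊤ := by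
  refine lt_of_le_of_lt (limsup_le_of_le (a := (K : ℝ≥0∞)) (by isBoundedDefault) ?_)
    (ENNReal.natCast_lt_top K)
  filter_upwards [hK] with n hn
  exact ENNReal.div_le_of_le_mul (by exact_mod_cast hn)

lemma exists_eventually_le_mul_of_ZgN_subset {f g : ℕ → ℕ} {M : ℕ} (hf : inHup f) (hg : inHup g)
    (hM : ∀ n, f (n + 1) ≤ f n + M) (hsub : ZgN g ⊆ ZgN f) :
    ∃ K, ∀ᶠ n in atTop, g n ≤ K * f n := by
  by_contra! hcon
  obtain ⟨A, hA, hA'⟩ := exists_mem_ZgN_notMem_ZgN hg.2 hg.tendsto hg.pos hf.pos (M + 1) (by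
    intro k N
    obtain ⟨n, hn, hlt⟩ := frequently_atTop.1 (hcon k) N
    refine ⟨n, n + f n, hn, Nat.le_add_right _ _, ?_, ?_⟩
    · simpa using hlt.le
    · have := le_add_mul_of_succ_le_add hM n (f n)
      rw [Nat.add_sub_cancel_left, Nat.add_mul]
      omega)
  exact hA' (hsub hA)

lemma exists_eventually_le_mul_of_subset_ZgN {f g : ℕ → ℕ} {M : ℕ} (hf : inHup f) (hg : inHup g)
    (hM : ∀ n, f (n + 1) ≤ f n + M) (hsub : ZgN f ⊆ ZgN g) :
    ∃ K, ∀ᶠ n in atTop, f n ≤ K * g n := by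
  by_contra! hcon
  obtain ⟨A, hA, hA'⟩ := exists_mem_ZgN_notMem_ZgN hf.2 hf.tendsto hf.pos hg.pos 1 (by
    intro k N
    obtain ⟨n, hn, hlt⟩ := frequently_atTop.1 (hcon (2 * M + k + 1)) (2 * N + 2 * f 0)
    set s := f n / (2 * M + k + 1) with hs
    have hsf : (2 * M + k + 1) * s ≤ f n := Nat.mul_div_le _ _
    have hgs : g n ≤ s := (Nat.le_div_iff_mul_le (by omega)).2 (by
      rw [Nat.mul_comm]
      exact hlt.le)
    have hfn : f n ≤ f 0 + M * n := by simpa using le_add_mul_of_succ_le_add hM 0 n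
    have hsn : 2 * s ≤ n := by
      by_contra! hns
      nlinarith [Nat.mul_le_mul_left M hns.le, Nat.zero_le (k * s)]
    have hsub' : n - (n - s) = s := by omega
    refine ⟨n - s, n, by omega, by omega, ?_, ?_⟩
    · have hadd := le_add_mul_of_succ_le_add hM (n - s) s
      rw [Nat.sub_add_cancel (by omega)] at hadd
      rw [hsub']
      nlinarith [Nat.zero_le (M * s)]
    · rw [hsub', Nat.one_mul]
      exact hgs)
  exact hA' (hsub hA)

/-- If `limsup (f(n+1) − f(n)) < ∞`, then `S_f` has exactly one element. -/
theorem card_Sf_eq_one_of_bounded_increments (f : ℕ → ℕ) (hf : inHup f)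
    (h : limsup (fun n => ((f (n + 1) - f n : ℕ) : ℝ≥0∞)) atTop < ⊤) :
    Cardinal.mk (Sf f) = 1 := by
  obtain ⟨M, hM⟩ := exists_forall_succ_le_add h
  rw [Cardinal.eq_one_iff_unique]
  have hrel : ∀ g : {g : ℕ → ℕ // inHup g ∧ ZgN g = ZgN f}, Rrel g.1 f := by
    rintro ⟨g, hg, hgf⟩
    obtain ⟨K, hK⟩ := exists_eventually_le_mul_of_ZgN_subset hf hg hM hgf.subset
    obtain ⟨L, hL⟩ := exists_eventually_le_mul_of_subset_ZgN hf hg hM hgf.symm.subset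
    exact ⟨limsup_div_lt_top hK, limsup_div_lt_top hL⟩
  let f' : {g : ℕ → ℕ // inHup g ∧ ZgN g = ZgN f} := ⟨f, hf, rfl⟩
  refine ⟨⟨?_⟩, ⟨Quot.mk _ f'⟩⟩
  rintro ⟨g⟩ ⟨g'⟩
  exact (Quot.sound (b := f') (hrel g)).trans (Quot.sound (b := f') (hrel g')).symm
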